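/- Let p be a prime with p ≡ 1 (mod 4), and write p = n + w with integers n, w satisfying 2 ≤ w < n. Suppose the Legendre symbol satisfies (y/p) = ((w−y)/p) for all integers 1 ≤ y < w/2. Then the map f(x) = (x^{(p+1)/2} mod p) permutes the residue classes: there is a permutation σ of {0, 1, ..., n−1} such that f(I_i) = I_{σ(i)} for every i. -/

import Mathlib

/-- `Iclass p n j` is the residue class `I_j = {x : 1 ≤ x ≤ p-1, x ≡ j (mod n)}`. -/
def Iclass (p n j : ℕ) : Finset ℕ :=
  (Finset.Icc 1 (p - 1)).filter fun x => x % n = j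

/-- `fmap p A k x` is `A x^k mod p`, the least residue in `{0, …, p-1}`. -/
def fmap (p : ℕ) (A : ℤ) (k : ℕ) (x : ℕ) : ℕ :=
  ((A : ZMod p) * (x : ZMod p) ^ k).val

theorem mem_Iclass {p n j x : ℕ} : x ∈ Iclass p n j ↔ (1 ≤ x ∧ x ≤ p - 1) ∧ x % n = j := by
  simp [Iclass]

/-- An involution of `{1, …, p-1}` that is compatible with congruence modulo `n` permutes the
residue classes modulo `n`. -/
theorem exists_perm_image_Iclass {p n : ℕ} (hn : 0 < n) (hnp : n < p) (f : ℕ → ℕ)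
    (hf : ∀ x, 1 ≤ x → x < p → 1 ≤ f x ∧ f x < p)
    (hinv : ∀ x, 1 ≤ x → x < p → f (f x) = x)
    (hcomp : ∀ x y, 1 ≤ x → x < p → 1 ≤ y → y < p → x % n = y % n → f x % n = f y % n) :
    ∃ σ : Equiv.Perm (Fin n), ∀ i : Fin n, (Iclass p n i).image f = Iclass p n (σ i) := by
  have hrep : ∀ i : Fin n, ∃ r, 1 ≤ r ∧ r < p ∧ r % n = i := by
    intro i
    rcases Nat.eq_zero_or_pos (i : ℕ) with h | h
    · exact ⟨n, hn, hnp, by simp [h]⟩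
    · exact ⟨i, h, i.2.trans hnp, Nat.mod_eq_of_lt i.2⟩
  choose r hr1 hrp hrn using hrep
  let s : Fin n → Fin n := fun i => ⟨f (r i) % n, Nat.mod_lt _ hn⟩
  have hs : ∀ (i : Fin n) (x : ℕ), 1 ≤ x → x < p → x % n = i → f x % n = s i := fun i x h1 h2 h3 =>
    hcomp x (r i) h1 h2 (hr1 i) (hrp i) (h3.trans (hrn i).symm)
  have hss : Function.Involutive s := by
    intro i
    obtain ⟨h1, h2⟩ := hf (r i) (hr1 i) (hrp i)
    have h := hs (s i) (f (r i)) h1 h2 rfl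
    rw [hinv _ (hr1 i) (hrp i), hrn] at h
    exact Fin.ext h.symm
  refine ⟨hss.toPerm, fun i => ?_⟩
  ext y
  simp only [Finset.mem_image, mem_Iclass, Function.Involutive.coe_toPerm]
  constructor
  · rintro ⟨x, ⟨⟨h1, h2⟩, h3⟩, rfl⟩
    have hx : x < p := by omega
    obtain ⟨h4, h5⟩ := hf x h1 hx
    exact ⟨⟨h4, by omega⟩, hs i x h1 hx h3⟩
  · rintro ⟨⟨h1, h2⟩, h3⟩
    have hy : y < p := by omega
    obtain ⟨h4, h5⟩ := hf y h1 hy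
    refine ⟨f y, ⟨⟨h4, by omega⟩, ?_⟩, hinv y h1 hy⟩
    rw [hs (s i) y h1 hy h3, hss i]

theorem legendreSym_neg_of_mod_four_eq_one {p : ℕ} [Fact p.Prime] (hp4 : p % 4 = 1) (a : ℤ) :
    legendreSym p (-a) = legendreSym p a := by
  rw [← neg_one_mul, legendreSym.mul, legendreSym.at_neg_one (by omega),
    ZMod.χ₄_nat_one_mod_four hp4, one_mul]

theorem legendreSym_add_self {p : ℕ} [Fact p.Prime] (a : ℤ) :
    legendreSym p (a + p) = legendreSym p a := by
  rw [legendreSym.mod p (a + p), legendreSym.mod p a, Int.add_emod_right]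

theorem legendreSym_natCast_sub {p x : ℕ} [Fact p.Prime] (hp4 : p % 4 = 1) (hx : x ≤ p) :
    legendreSym p ((p - x : ℕ) : ℤ) = legendreSym p x := by
  rw [Nat.cast_sub hx, sub_eq_neg_add, legendreSym_add_self,
    legendreSym_neg_of_mod_four_eq_one hp4]

theorem fmap_half_eq_ite {p : ℕ} [Fact p.Prime] (hp2 : p % 2 = 1) {x : ℕ} (h1 : 1 ≤ x)
    (hx : x < p) :
    fmap p 1 ((p + 1) / 2) x = if legendreSym p x = 1 then x else p - x := by
  have hx0 : ((x : ℤ) : ZMod p) ≠ 0 := by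
    rw [Int.cast_natCast, Ne, ZMod.natCast_eq_zero_iff]
    exact Nat.not_dvd_of_pos_of_lt h1 hx
  have hpow : ((1 : ℤ) : ZMod p) * (x : ZMod p) ^ ((p + 1) / 2)
      = (legendreSym p x : ZMod p) * x := by
    rw [legendreSym.eq_pow, show (p + 1) / 2 = p / 2 + 1 by omega, pow_succ]
    simp
  rw [fmap, hpow]
  rcases legendreSym.eq_one_or_neg_one p hx0 with h | h
  · simp [h, ZMod.val_cast_of_lt hx]
  · have hcast : (-1 : ZMod p) * x = ((p - x : ℕ) : ZMod p) := by
      rw [Nat.cast_sub hx.le]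
      simp
    rw [h, if_neg (by decide), Int.cast_neg, Int.cast_one, hcast, ZMod.val_cast_of_lt (by omega)]

theorem stmt_13 (p n w : ℕ) [hp : Fact p.Prime] (hp4 : p % 4 = 1)
    (hw : 2 ≤ w) (hwn : w < n) (hpnw : p = n + w)
    (hleg : ∀ y : ℕ, 1 ≤ y → 2 * y < w → legendreSym p y = legendreSym p (w - y)) :
    ∃ σ : Equiv.Perm (Fin n), ∀ i : Fin n,
      (Iclass p n i).image (fmap p 1 ((p + 1) / 2)) = Iclass p n (σ i) := by
  have hf : ∀ x, 1 ≤ x → x < p →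
      fmap p 1 ((p + 1) / 2) x = if legendreSym p x = 1 then x else p - x :=
    fun x h1 h2 => fmap_half_eq_ite (by omega) h1 h2
  have hrefl : ∀ x : ℕ, 1 ≤ x → x < w → legendreSym p x = legendreSym p ((w - x : ℕ) : ℤ) := by
    intro x h1 h2
    rcases lt_trichotomy (2 * x) w with h | h | h
    · rw [hleg x h1 h, Nat.cast_sub h2.le]
    · rw [show w - x = x by omega]
    · rw [hleg (w - x) (by omega) (by omega), Nat.cast_sub h2.le, sub_sub_cancel]
  have hshift : ∀ x : ℕ, 1 ≤ x → x < w →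
      legendreSym p ((x + n : ℕ) : ℤ) = legendreSym p x := by
    intro x h1 h2
    rw [hrefl x h1 h2, ← legendreSym_natCast_sub hp4 (show w - x ≤ p by omega),
      show p - (w - x) = x + n by omega]
  refine exists_perm_image_Iclass (by omega) (by omega) _ ?_ ?_ ?_
  · intro x h1 h2
    rw [hf x h1 h2]
    split_ifs <;> omega
  · intro x h1 h2
    by_cases h : legendreSym p x = 1
    · have hx : fmap p 1 ((p + 1) / 2) x = x := by rw [hf x h1 h2, if_pos h]
      rw [hx, hx]
    · rw [hf x h1 h2, if_neg h, hf (p - x) (by omega) (by omega),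
        legendreSym_natCast_sub hp4 h2.le, if_neg h, Nat.sub_sub_self h2.le]
  · have key : ∀ x, 1 ≤ x → x < w →
        fmap p 1 ((p + 1) / 2) (x + n) % n = fmap p 1 ((p + 1) / 2) x % n := by
      intro x h1 h2
      rw [hf x h1 (by omega), hf (x + n) (by omega) (by omega), hshift x h1 h2]
      split_ifs
      · exact Nat.add_mod_right x n
      · rw [show p - x = p - (x + n) + n by omega, Nat.add_mod_right]
    have hlt : ∀ x y, 1 ≤ x → y < p → x < y → x % n = y % n → y = x + n ∧ x < w := by
      intro x y h1 h2 hxy h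
      obtain ⟨k, hk⟩ := (Nat.modEq_iff_dvd' hxy.le).mp h
      have hk1 : k = 1 := by
        have : 0 < k := Nat.pos_of_ne_zero (by rintro rfl; omega)
        have : k < 2 := by
          by_contra! hk2
          have := Nat.mul_le_mul_left n hk2
          omega
        omega
      subst hk1
      omega
    intro x y hx1 hxp hy1 hyp h
    rcases lt_trichotomy x y with hxy | rfl | hxy
    · obtain ⟨rfl, h2⟩ := hlt x y hx1 hyp hxy h
      exact (key x hx1 h2).symm
    · rfl
    · obtain ⟨rfl, h2⟩ := hlt y x hy1 hxp hxy h.symm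
      exact key y hy1 h2
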